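/- Proportionality of the two tau functions (Eq. (tautau)): let C be a real N×N_b matrix of rank N_b and C' a real N_a×N matrix of rank N_a with C' r C = 0. Then there exists a nonzero real constant c₀ such that for all positive real numbers e_1,…,e_N, with E = diag(e_1,…,e_N), det(V E C) = c₀ · (∏_{n=1}^N e_n) · det(C' E^{−1} V'). -/

import Mathlib

open Finset Matrix

noncomputable section

/-- `rProd κ n = ∏_{m ≠ n} (κ n - κ m)`. -/
def rProd {N : ℕ} (κ : Fin N → ℝ) (n : Fin N) : ℝ :=
  ∏ m ∈ Finset.univ.erase n, (κ n - κ m)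

/-- The incomplete Vandermonde matrix `V`, of size `N_b × N`. -/
def Vmat (Na Nb : ℕ) (κ : Fin (Na + Nb) → ℝ) : Matrix (Fin Nb) (Fin (Na + Nb)) ℝ :=
  Matrix.of fun i n => κ n ^ (i : ℕ)

/-- The incomplete Vandermonde matrix `V'`, of size `N × N_a`. -/
def Vmat' (Na Nb : ℕ) (κ : Fin (Na + Nb) → ℝ) : Matrix (Fin (Na + Nb)) (Fin Na) ℝ :=
  Matrix.of fun n j => κ n ^ (j : ℕ)

theorem exists_right_inverse_of_rank_eq_card {K m n : Type*} [Field K] [Fintype m] [DecidableEq m]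
    [Fintype n] (A : Matrix m n K) (hA : A.rank = Fintype.card m) :
    ∃ B : Matrix n m K, A * B = 1 := by
  classical
  rw [← Matrix.mulVec_surjective_iff_exists_right_inverse]
  have h : LinearMap.range A.mulVecLin = ⊤ :=
    Submodule.eq_top_of_finrank_eq (by rw [Module.finrank_fintype_fun_eq_card, ← hA]; rfl)
  exact LinearMap.range_eq_top.mp h

theorem exists_left_inverse_of_rank_eq_card {K m n : Type*} [Field K] [Fintype m] [Fintype n]
    [DecidableEq n] (A : Matrix m n K) (hA : A.rank = Fintype.card n) :
    ∃ B : Matrix n m K, B * A = 1 := by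
  obtain ⟨B, hB⟩ := exists_right_inverse_of_rank_eq_card Aᵀ (by rw [Matrix.rank_transpose, hA])
  exact ⟨Bᵀ, by rw [← Matrix.transpose_inj]; simpa using hB⟩

theorem det_fromRows_mul_det_fromCols {R m n k : Type*} [CommRing R] [Fintype m] [DecidableEq m]
    [Fintype n] [DecidableEq n] [Fintype k] (s : m ⊕ n ≃ k) (A : Matrix m k R)
    (B : Matrix n k R) (P : Matrix k m R) (Q : Matrix k n R) :
    ((fromRows A B).submatrix id s).det * ((fromCols P Q).submatrix s id).det =
      (fromBlocks (A * P) (A * Q) (B * P) (B * Q)).det := by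
  rw [← det_mul, submatrix_mul_equiv, fromRows_mul_fromCols, submatrix_id_id]

theorem rProd_ne_zero {N : ℕ} {κ : Fin N → ℝ} (hκ : Function.Injective κ) (n : Fin N) :
    rProd κ n ≠ 0 :=
  Finset.prod_ne_zero_iff.mpr fun _ hm =>
    sub_ne_zero.mpr fun h => (Finset.mem_erase.mp hm).1 (hκ h).symm

theorem sum_pow_div_rProd_eq_zero {N : ℕ} {κ : Fin N → ℝ} (hκ : Function.Injective κ) {k : ℕ}
    (hk : k + 1 < N) : ∑ n, κ n ^ k / rProd κ n = 0 := by
  have h := Lagrange.coeff_eq_sum (s := Finset.univ) (v := κ) hκ.injOn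
    (P := (Polynomial.X : Polynomial ℝ) ^ k) (by simp; omega)
  rw [Polynomial.coeff_X_pow, if_neg (by simp; omega)] at h
  simpa [rProd] using h.symm

theorem Vmat_mul_diagonal_inv_rProd_mul_Vmat' {Na Nb : ℕ} {κ : Fin (Na + Nb) → ℝ}
    (hκ : Function.Injective κ) :
    Vmat Na Nb κ * (Matrix.diagonal (fun n => (rProd κ n)⁻¹) * Vmat' Na Nb κ) = 0 := by
  ext i j
  rw [Matrix.mul_apply, Matrix.zero_apply,
    ← sum_pow_div_rProd_eq_zero hκ (k := (i : ℕ) + j) (by omega)]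
  refine Finset.sum_congr rfl fun n _ => ?_
  simp only [Vmat, Vmat', Matrix.diagonal_mul, Matrix.of_apply]
  ring

theorem exists_Vmat'_left_inverse {Na Nb : ℕ} {κ : Fin (Na + Nb) → ℝ}
    (hκ : Function.Injective κ) :
    ∃ L : Matrix (Fin Na) (Fin (Na + Nb)) ℝ, L * Vmat' Na Nb κ = 1 := by
  have hdet := isUnit_iff_ne_zero.mpr (Matrix.det_vandermonde_ne_zero_iff.mpr hκ)
  refine ⟨(vandermonde κ)⁻¹.submatrix (Fin.castAdd Nb) id, ?_⟩
  have h : Vmat' Na Nb κ = (vandermonde κ).submatrix id (Fin.castAdd Nb) := rfl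
  rw [h, ← submatrix_mul _ _ _ _ _ Function.bijective_id, Matrix.nonsing_inv_mul _ hdet,
    submatrix_one _ (Fin.castAdd_injective Na Nb)]

theorem exists_Vmat_right_inverse {Na Nb : ℕ} {κ : Fin (Na + Nb) → ℝ}
    (hκ : Function.Injective κ) :
    ∃ Q : Matrix (Fin (Na + Nb)) (Fin Nb) ℝ, Vmat Na Nb κ * Q = 1 := by
  have hdet := isUnit_iff_ne_zero.mpr (Matrix.det_vandermonde_ne_zero_iff.mpr hκ)
  have hinj : Function.Injective (Fin.castLE (Nat.le_add_left Nb Na)) := Fin.castLE_injective _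
  refine ⟨((vandermonde κ)⁻¹)ᵀ.submatrix id (Fin.castLE (Nat.le_add_left Nb Na)), ?_⟩
  have h : Vmat Na Nb κ =
    (vandermonde κ)ᵀ.submatrix (Fin.castLE (Nat.le_add_left Nb Na)) id := rfl
  rw [h, ← submatrix_mul _ _ _ _ _ Function.bijective_id, ← transpose_mul,
    Matrix.nonsing_inv_mul _ hdet, transpose_one, submatrix_one _ hinj]

/-- Proportionality of the two tau functions (Eq. (tautau)):
`det(V E C) = c₀ ⬝ (∏ e_n) ⬝ det(C' E⁻¹ V')` for a nonzero constant `c₀` independent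
of the positive weights `e`. -/
theorem tau_functions_proportional (Na Nb : ℕ) (hNa : 1 ≤ Na) (hNb : 1 ≤ Nb)
    (κ : Fin (Na + Nb) → ℝ) (hκ : StrictMono κ)
    (C : Matrix (Fin (Na + Nb)) (Fin Nb) ℝ) (hC : C.rank = Nb)
    (C' : Matrix (Fin Na) (Fin (Na + Nb)) ℝ) (hC' : C'.rank = Na)
    (horth : C' * Matrix.diagonal (rProd κ) * C = 0) :
    ∃ c₀ : ℝ, c₀ ≠ 0 ∧ ∀ e : Fin (Na + Nb) → ℝ, (∀ n, 0 < e n) →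
      (Vmat Na Nb κ * Matrix.diagonal e * C).det =
        c₀ * (∏ n, e n) * (C' * Matrix.diagonal (fun n => (e n)⁻¹) * Vmat' Na Nb κ).det := by
  have hinj := hκ.injective
  have hr := rProd_ne_zero hinj
  let s : Fin Nb ⊕ Fin Na ≃ Fin (Na + Nb) := (Equiv.sumComm _ _).trans finSumFinEquiv
  set D := Matrix.diagonal (rProd κ)
  set R := Matrix.diagonal (fun n => (rProd κ n)⁻¹)
  have hDR : D * R = 1 := by simp [D, R, Matrix.diagonal_mul_diagonal, hr]
  obtain ⟨L, hL⟩ := exists_left_inverse_of_rank_eq_card C (by simpa using hC)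
  obtain ⟨P, hP⟩ := exists_right_inverse_of_rank_eq_card C' (by simpa using hC')
  obtain ⟨L', hL'⟩ := exists_Vmat'_left_inverse (Na := Na) (Nb := Nb) hinj
  obtain ⟨Q, hQ⟩ := exists_Vmat_right_inverse (Na := Na) (Nb := Nb) hinj
  have hVV := Vmat_mul_diagonal_inv_rProd_mul_Vmat' (Na := Na) (Nb := Nb) hinj
  have cancel {l p : Type} (X : Matrix l (Fin (Na + Nb)) ℝ)
      (Y : Matrix (Fin (Na + Nb)) p ℝ) : X * D * (R * Y) = X * Y := by
    rw [Matrix.mul_assoc, ← Matrix.mul_assoc D, hDR, Matrix.one_mul]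
  have hCP : C' * D * (R * P) = 1 := by rw [cancel, hP]
  set c₁ := ((fromCols C (R * P)).submatrix s id).det
  set c₂ := ((fromCols Q (R * Vmat' Na Nb κ)).submatrix s id).det
  have hc₁ : c₁ ≠ 0 := by
    have h := det_fromRows_mul_det_fromCols s L (C' * D) C (R * P)
    rw [hL, horth, hCP, det_fromBlocks_zero₂₁, det_one, det_one, mul_one] at h
    exact right_ne_zero_of_mul_eq_one h
  have hc₂ : c₂ ≠ 0 := by
    have h := det_fromRows_mul_det_fromCols s (Vmat Na Nb κ) (L' * D) Q (R * Vmat' Na Nb κ)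
    rw [hQ, hVV, cancel, hL', det_fromBlocks_zero₁₂, det_one, det_one, mul_one] at h
    exact right_ne_zero_of_mul_eq_one h
  refine ⟨c₁ / c₂, div_ne_zero hc₁ hc₂, fun e he => ?_⟩
  have he' n : e n ≠ 0 := (he n).ne'
  set E := Matrix.diagonal e
  set F := Matrix.diagonal (fun n => (e n)⁻¹)
  have hEF : E * F = 1 := by simp [E, F, Matrix.diagonal_mul_diagonal, he']
  have hFR : F * R = R * F := by
    simp only [F, R, Matrix.diagonal_mul_diagonal, mul_comm]
  have hF {p : Type} (Y : Matrix (Fin (Na + Nb)) p ℝ) :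
      Vmat Na Nb κ * E * (F * Y) = Vmat Na Nb κ * Y := by
    rw [Matrix.mul_assoc, ← Matrix.mul_assoc E, hEF, Matrix.one_mul]
  have h₁ := det_fromRows_mul_det_fromCols s (Vmat Na Nb κ * E) (C' * D) C (R * P)
  rw [horth, hCP, det_fromBlocks_zero₂₁, det_one, mul_one] at h₁
  have h₂ := det_fromRows_mul_det_fromCols s (Vmat Na Nb κ * E) (C' * D) (F * Q)
    (F * (R * Vmat' Na Nb κ))
  have hCF : C' * D * (F * (R * Vmat' Na Nb κ)) = C' * F * Vmat' Na Nb κ := by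
    rw [← Matrix.mul_assoc F, hFR, Matrix.mul_assoc R, cancel, Matrix.mul_assoc]
  rw [hF, hF, hQ, hVV, hCF, det_fromBlocks_zero₁₂, det_one, one_mul, ← mul_fromCols,
    ← submatrix_mul_equiv F _ s s id, det_mul, det_submatrix_equiv_self, det_diagonal,
    Finset.prod_inv_distrib] at h₂
  have hprod : ∏ n, e n ≠ 0 := Finset.prod_ne_zero_iff.mpr fun n _ => he' n
  change _ * c₁ = _ at h₁
  change _ * (_ * c₂) = _ at h₂
  rw [← h₁, ← h₂]
  field_simp

end
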